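/- If c·T ≤ √3·π, then 0 ∈ I(p₀) for every continuous T-periodic p₀ : ℝ → ℝ with zero average over [0, T]; that is, the equation (φ(x'(t)))' + a·x'(t) + b·sin(x(t)) = p₀(t) has at least one T-periodic solution. -/

import Mathlib

open Real Set MeasureTheory

/-- The relativistic operator `φ(v) = v / √(1 - v²/c²)`. -/
noncomputable def phi (c v : ℝ) : ℝ := v / Real.sqrt (1 - v ^ 2 / c ^ 2)

/-- `x` is a `T`-periodic solution of the relativistic pendulum equation
`(φ(x'))' + a x' + b sin x = p`. -/
def IsPendSol (c a b T : ℝ) (p x : ℝ → ℝ) : Prop :=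
  Function.Periodic x T ∧
  ContDiff ℝ 1 x ∧
  (∀ t : ℝ, |deriv x t| < c) ∧
  ContDiff ℝ 1 (fun t : ℝ => phi c (deriv x t)) ∧
  ∀ t : ℝ, deriv (fun τ : ℝ => phi c (deriv x τ)) t + a * deriv x t + b * Real.sin (x t) = p t

/-- The solvability set `I(p₀)`: the values `s` for which the relativistic pendulum
equation with forcing `p₀ + s` has a `T`-periodic solution. -/
def solvSet (c a b T : ℝ) (p₀ : ℝ → ℝ) : Set ℝ :=
  {s : ℝ | ∃ x : ℝ → ℝ, IsPendSol c a b T (fun t => p₀ t + s) x}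


noncomputable def Lop (k : ℝ) (h : ℝ → ℝ) (t : ℝ) : ℝ :=
  ∫ s in Ioi (0:ℝ), Real.exp (-k * s) * h (t + s)

noncomputable def Rop (k : ℝ) (h : ℝ → ℝ) (t : ℝ) : ℝ :=
  Lop k (fun s => h (-s)) (-t)

lemma Lop_int {k M : ℝ} (hk : 0 < k) {h : ℝ → ℝ} (hm : Measurable h) (hM : ∀ t, |h t| ≤ M) (t r : ℝ) :
    IntegrableOn (fun s => Real.exp (-k * s) * h (t + s)) (Ioi r) := by
  have h1 : IntegrableOn (fun s => Real.exp (-k * s)) (Ioi r) := integrableOn_exp_mul_Ioi (by linarith) r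
  refine Integrable.mul_bdd (c := M) h1 ?_ ?_
  · exact (hm.comp (measurable_const_add t)).aestronglyMeasurable
  · exact Filter.Eventually.of_forall fun s => by simpa using hM (t + s)

lemma Lop_mono {k M M' : ℝ} (hk : 0 < k) {h h' : ℝ → ℝ} (hm : Measurable h) (hM : ∀ t, |h t| ≤ M)
    (hm' : Measurable h') (hM' : ∀ t, |h' t| ≤ M') (hle : ∀ t, h t ≤ h' t) (t : ℝ) :
    Lop k h t ≤ Lop k h' t := by
  unfold Lop
  refine integral_mono (Lop_int hk hm hM t 0) (Lop_int hk hm' hM' t 0) ?_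
  intro s
  exact mul_le_mul_of_nonneg_left (hle _) (Real.exp_pos _).le

lemma Lop_per {k T : ℝ} {h : ℝ → ℝ} (hp : Function.Periodic h T) : Function.Periodic (Lop k h) T := by
  intro t
  unfold Lop
  congr 1
  ext s
  rw [show t + T + s = (t + s) + T by ring, hp]

lemma Lop_eq {k M : ℝ} (hk : 0 < k) {h : ℝ → ℝ} (hm : Measurable h) (hM : ∀ t, |h t| ≤ M) (t : ℝ) :
    Lop k h t = Real.exp (k * t) * (Lop k h 0 - ∫ s in (0:ℝ)..t, Real.exp (-k * s) * h s) := by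
  have hI : ∀ r, IntegrableOn (fun s => Real.exp (-k * s) * h s) (Ioi r) := by
    intro r
    simpa using Lop_int hk hm hM 0 r
  have h1 : Lop k h 0 = ∫ s in Ioi (0:ℝ), Real.exp (-k * s) * h s := by simp [Lop]
  rw [h1, ← intervalIntegral.integral_Ioi_sub_Ioi' (hI 0) (hI t), sub_sub_cancel]
  unfold Lop
  have h2 := (measurePreserving_add_right volume t).setIntegral_preimage_emb
    (measurableEmbedding_addRight t) (fun s => Real.exp (-k * s) * h s) (Ioi t)
  have h3 : (fun x => x + t) ⁻¹' (Ioi t) = Ioi 0 := by ext; simp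
  rw [h3] at h2
  rw [← h2, ← integral_const_mul]
  congr 1
  ext s
  rw [← mul_assoc, ← Real.exp_add, add_comm s t]
  congr 2
  ring

lemma Lop_cont {k M : ℝ} (hk : 0 < k) {h : ℝ → ℝ} (hm : Measurable h) (hM : ∀ t, |h t| ≤ M) :
    Continuous (Lop k h) := by
  have : Lop k h = fun t => Real.exp (k * t) * (Lop k h 0 - ∫ s in (0:ℝ)..t, Real.exp (-k * s) * h s) := by
    ext t; exact Lop_eq hk hm hM t
  rw [this]
  have hc : Continuous fun t => ∫ s in (0:ℝ)..t, Real.exp (-k * s) * h s := by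
    apply intervalIntegral.continuous_primitive
    intro a b
    constructor
    · have := (Lop_int hk hm hM 0 a)
      simp only [zero_add] at this
      exact this.mono_set Ioc_subset_Ioi_self
    · have := (Lop_int hk hm hM 0 b)
      simp only [zero_add] at this
      exact this.mono_set Ioc_subset_Ioi_self
  fun_prop

lemma Lop_deriv {k M : ℝ} (hk : 0 < k) {h : ℝ → ℝ} (hm : Continuous h) (hM : ∀ t, |h t| ≤ M) (t : ℝ) :
    HasDerivAt (Lop k h) (k * Lop k h t - h t) t := by
  have hc : Continuous fun s => Real.exp (-k * s) * h s := by fun_prop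
  have h1 := intervalIntegral.integral_hasDerivAt_right (hc.intervalIntegrable 0 t)
    (hc.stronglyMeasurableAtFilter _ _) hc.continuousAt
  have h2 : HasDerivAt (fun t => Real.exp (k * t)) (Real.exp (k * t) * k) t := by
    simpa using ((hasDerivAt_id t).const_mul k).exp
  have h3 := h2.mul (h1.const_sub (Lop k h 0))
  have : Real.exp (k * t) * Real.exp (-k * t) = 1 := by rw [← Real.exp_add]; simp
  have e2 : Real.exp (k * t) * -(Real.exp (-k * t) * h t) = - h t := by
    rw [mul_neg, ← mul_assoc, this, one_mul]
  have h4 : HasDerivAt (Lop k h) (Real.exp (k * t) * k * (Lop k h 0 - ∫ (x : ℝ) in 0..t, Real.exp (-k * x) * h x)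
      + Real.exp (k * t) * -(Real.exp (-k * t) * h t)) t := by
    refine HasDerivAt.congr_of_eventuallyEq h3 (Filter.Eventually.of_forall fun x => ?_)
    exact Lop_eq hk hm.measurable hM x
  refine h4.congr_deriv ?_
  rw [e2, Lop_eq hk hm.measurable hM t]
  ring

lemma Lop_repr {k M M' : ℝ} (hk : 0 < k) {w w' : ℝ → ℝ} (hw : ∀ t, HasDerivAt w (w' t) t)
    (hc : Continuous w') (hM : ∀ t, |w t| ≤ M) (hM' : ∀ t, |w' t| ≤ M') (t : ℝ) :
    Lop k (fun s => k * w s - w' s) t = w t := by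
  have hwc : Continuous w := continuous_iff_continuousAt.2 fun t => (hw t).continuousAt
  have hd : ∀ s ∈ Ici (0:ℝ), HasDerivAt (fun s => - (Real.exp (-k * s) * w (t + s)))
      (Real.exp (-k * s) * (k * w (t+s) - w' (t+s))) s := by
    intro s _
    have h2 : HasDerivAt (fun t => Real.exp (-k * t)) (Real.exp (-k * s) * (-k)) s := by
      simpa using ((hasDerivAt_id s).const_mul (-k)).exp
    have h3 : HasDerivAt (fun s => w (t + s)) (w' (t + s)) s := (hw (t+s)).comp_const_add t s
    refine HasDerivAt.congr_deriv (h2.mul h3).neg ?_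
    ring
  have hb : ∀ s, |k * w s - w' s| ≤ k * M + M' := by
    intro s
    calc |k * w s - w' s| ≤ |k * w s| + |w' s| := abs_sub _ _
      _ ≤ _ := by
        rw [abs_mul, abs_of_pos hk]
        gcongr
        · exact hM s
        · exact hM' s
  have hint := Lop_int hk (h := fun s => k * w s - w' s) (by fun_prop) hb t 0
  have htend : Filter.Tendsto (fun s => - (Real.exp (-k * s) * w (t + s))) Filter.atTop (nhds 0) := by
    have hexp : Filter.Tendsto (fun s => Real.exp (-k * s)) Filter.atTop (nhds 0) := by
      apply Real.tendsto_exp_atBot.comp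
      exact Filter.tendsto_id.const_mul_atTop_of_neg (by linarith)
    have := hexp.zero_mul_isBoundedUnder_le (g := fun s => w (t + s))
      (Filter.isBoundedUnder_of ⟨M, fun s => by simpa using hM (t + s)⟩)
    simpa using this.neg
  have := integral_Ioi_of_hasDerivAt_of_tendsto' hd hint htend
  unfold Lop
  rw [this]
  simp

lemma Lop_tendsto {k M : ℝ} (hk : 0 < k) {h : ℕ → ℝ → ℝ} {h' : ℝ → ℝ} (hm : ∀ n, Measurable (h n))
    (hM : ∀ n t, |h n t| ≤ M) (hlim : ∀ t, Filter.Tendsto (fun n => h n t) Filter.atTop (nhds (h' t))) (t : ℝ) :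
    Filter.Tendsto (fun n => Lop k (h n) t) Filter.atTop (nhds (Lop k h' t)) := by
  unfold Lop
  apply tendsto_integral_of_dominated_convergence (fun s => Real.exp (-k * s) * M)
  · intro n
    exact (Lop_int hk (hm n) (hM n) t 0).aestronglyMeasurable
  · exact (integrableOn_exp_mul_Ioi (by linarith) 0).mul_const M
  · intro n
    refine Filter.Eventually.of_forall fun s => ?_
    rw [Real.norm_eq_abs, abs_mul, abs_of_pos (Real.exp_pos _)]
    exact mul_le_mul_of_nonneg_left (hM n _) (Real.exp_pos _).le
  · refine Filter.Eventually.of_forall fun s => ?_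
    exact (hlim _).const_mul _

lemma Rop_mono {k M M' : ℝ} (hk : 0 < k) {h h' : ℝ → ℝ} (hm : Measurable h) (hM : ∀ t, |h t| ≤ M)
    (hm' : Measurable h') (hM' : ∀ t, |h' t| ≤ M') (hle : ∀ t, h t ≤ h' t) (t : ℝ) :
    Rop k h t ≤ Rop k h' t :=
  Lop_mono hk (hm.comp measurable_neg) (fun _ => hM _) (hm'.comp measurable_neg) (fun _ => hM' _)
    (fun _ => hle _) _

lemma Rop_per {k T : ℝ} {h : ℝ → ℝ} (hp : Function.Periodic h T) : Function.Periodic (Rop k h) T := by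
  intro t
  unfold Rop
  have : Function.Periodic (fun s => h (-s)) T := by
    intro s
    have := hp (-s - T)
    simp only [sub_add_cancel] at this
    simp only
    rw [this]
    congr 1
    ring
  have h2 := Lop_per (k := k) this (-(t + T))
  rw [← h2]
  congr 1
  ring

lemma Rop_cont {k M : ℝ} (hk : 0 < k) {h : ℝ → ℝ} (hm : Measurable h) (hM : ∀ t, |h t| ≤ M) :
    Continuous (Rop k h) :=
  (Lop_cont hk (hm.comp measurable_neg) (fun _ => hM _)).comp continuous_neg

lemma Rop_deriv {k M : ℝ} (hk : 0 < k) {h : ℝ → ℝ} (hm : Continuous h) (hM : ∀ t, |h t| ≤ M) (t : ℝ) :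
    HasDerivAt (Rop k h) (h t - k * Rop k h t) t := by
  have := Lop_deriv hk (hm.comp continuous_neg) (fun t => hM (-t)) (-t)
  have h2 := HasDerivAt.scomp t this (hasDerivAt_neg t)
  refine HasDerivAt.congr_deriv h2 ?_
  simp [Rop, Function.comp_def]

lemma Rop_repr {k M M' : ℝ} (hk : 0 < k) {w w' : ℝ → ℝ} (hw : ∀ t, HasDerivAt w (w' t) t)
    (hc : Continuous w') (hM : ∀ t, |w t| ≤ M) (hM' : ∀ t, |w' t| ≤ M') (t : ℝ) :
    Rop k (fun s => k * w s + w' s) t = w t := by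
  have := Lop_repr (w := fun t => w (-t)) (w' := fun t => - w' (-t)) hk (fun t => by
    have h2 := HasDerivAt.scomp t (hw (-t)) (hasDerivAt_neg t)
    refine HasDerivAt.congr_deriv h2 ?_
    simp) (by fun_prop) (fun t => hM (-t)) (fun t => by simpa using hM' (-t)) (-t)
  simpa [Rop] using this

lemma Rop_tendsto {k M : ℝ} (hk : 0 < k) {h : ℕ → ℝ → ℝ} {h' : ℝ → ℝ} (hm : ∀ n, Measurable (h n))
    (hM : ∀ n t, |h n t| ≤ M) (hlim : ∀ t, Filter.Tendsto (fun n => h n t) Filter.atTop (nhds (h' t))) (t : ℝ) :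
    Filter.Tendsto (fun n => Rop k (h n) t) Filter.atTop (nhds (Rop k h' t)) :=
  Lop_tendsto hk (fun n => (hm n).comp measurable_neg) (fun n _ => hM n _) (fun _ => hlim _) _

lemma per_bdd {T : ℝ} (hT : 0 < T) {f : ℝ → ℝ} (hf : Continuous f) (hp : Function.Periodic f T) :
    ∃ M, ∀ t, |f t| ≤ M := by
  obtain ⟨M, hM⟩ := (isCompact_Icc (a := (0:ℝ)) (b := T)).exists_bound_of_continuousOn hf.continuousOn
  refine ⟨M, fun t => ?_⟩
  obtain ⟨y, hy, e⟩ := hp.exists_mem_Ico₀ hT t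
  rw [e]
  exact hM y ⟨hy.1, hy.2.le⟩

lemma Rop_ge {k T : ℝ} (hk : 0 < k) (hT : 0 < T) {x x' h : ℝ → ℝ} (hx : ∀ t, HasDerivAt x (x' t) t)
    (hc : Continuous x') (hp : Function.Periodic x T) (hp' : Function.Periodic x' T)
    (hh : Continuous h) (hhp : Function.Periodic h T) (hle : ∀ t, k * x t + x' t ≤ h t) (t : ℝ) :
    x t ≤ Rop k h t := by
  have hxc : Continuous x := continuous_iff_continuousAt.2 fun t => (hx t).continuousAt
  obtain ⟨M, hM⟩ := per_bdd hT hxc hp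
  obtain ⟨M', hM'⟩ := per_bdd hT hc hp'
  obtain ⟨N, hN⟩ := per_bdd hT hh hhp
  obtain ⟨N', hN'⟩ := per_bdd hT (f := fun t => k * x t + x' t) (by fun_prop)
    (fun t => by simp only [hp t, hp' t])
  rw [← Rop_repr hk hx hc hM hM' t]
  exact Rop_mono hk (by fun_prop) hN' hh.measurable hN hle t

lemma Rop_le {k T : ℝ} (hk : 0 < k) (hT : 0 < T) {x x' h : ℝ → ℝ} (hx : ∀ t, HasDerivAt x (x' t) t)
    (hc : Continuous x') (hp : Function.Periodic x T) (hp' : Function.Periodic x' T)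
    (hh : Continuous h) (hhp : Function.Periodic h T) (hle : ∀ t, h t ≤ k * x t + x' t) (t : ℝ) :
    Rop k h t ≤ x t := by
  have hxc : Continuous x := continuous_iff_continuousAt.2 fun t => (hx t).continuousAt
  obtain ⟨M, hM⟩ := per_bdd hT hxc hp
  obtain ⟨M', hM'⟩ := per_bdd hT hc hp'
  obtain ⟨N, hN⟩ := per_bdd hT hh hhp
  obtain ⟨N', hN'⟩ := per_bdd hT (f := fun t => k * x t + x' t) (by fun_prop)
    (fun t => by simp only [hp t, hp' t])
  rw [← Rop_repr hk hx hc hM hM' t]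
  exact Rop_mono hk hh.measurable hN (by fun_prop) hN' hle t

lemma Lop_ge {k T : ℝ} (hk : 0 < k) (hT : 0 < T) {x x' h : ℝ → ℝ} (hx : ∀ t, HasDerivAt x (x' t) t)
    (hc : Continuous x') (hp : Function.Periodic x T) (hp' : Function.Periodic x' T)
    (hh : Continuous h) (hhp : Function.Periodic h T) (hle : ∀ t, k * x t - x' t ≤ h t) (t : ℝ) :
    x t ≤ Lop k h t := by
  have hxc : Continuous x := continuous_iff_continuousAt.2 fun t => (hx t).continuousAt
  obtain ⟨M, hM⟩ := per_bdd hT hxc hp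
  obtain ⟨M', hM'⟩ := per_bdd hT hc hp'
  obtain ⟨N, hN⟩ := per_bdd hT hh hhp
  obtain ⟨N', hN'⟩ := per_bdd hT (f := fun t => k * x t - x' t) (by fun_prop)
    (fun t => by simp only [hp t, hp' t])
  rw [← Lop_repr hk hx hc hM hM' t]
  exact Lop_mono hk (by fun_prop) hN' hh.measurable hN hle t

lemma Lop_le {k T : ℝ} (hk : 0 < k) (hT : 0 < T) {x x' h : ℝ → ℝ} (hx : ∀ t, HasDerivAt x (x' t) t)
    (hc : Continuous x') (hp : Function.Periodic x T) (hp' : Function.Periodic x' T)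
    (hh : Continuous h) (hhp : Function.Periodic h T) (hle : ∀ t, h t ≤ k * x t - x' t) (t : ℝ) :
    Lop k h t ≤ x t := by
  have hxc : Continuous x := continuous_iff_continuousAt.2 fun t => (hx t).continuousAt
  obtain ⟨M, hM⟩ := per_bdd hT hxc hp
  obtain ⟨M', hM'⟩ := per_bdd hT hc hp'
  obtain ⟨N, hN⟩ := per_bdd hT hh hhp
  obtain ⟨N', hN'⟩ := per_bdd hT (f := fun t => k * x t - x' t) (by fun_prop)
    (fun t => by simp only [hp t, hp' t])
  rw [← Lop_repr hk hx hc hM hM' t]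
  exact Lop_mono hk hh.measurable hN (by fun_prop) hN' hle t

/-- Monotone iteration for a cooperative pair of first-order periodic problems, one solved
forward and one solved backward in time. -/
theorem mono_iter {k T : ℝ} (hk : 0 < k) (hT : 0 < T) {G H : ℝ → ℝ → ℝ → ℝ}
    (hG : Continuous fun q : ℝ × ℝ × ℝ => G q.1 q.2.1 q.2.2)
    (hH : Continuous fun q : ℝ × ℝ × ℝ => H q.1 q.2.1 q.2.2)
    (hGp : ∀ t x w, G (t + T) x w = G t x w) (hHp : ∀ t x w, H (t + T) x w = H t x w)
    (hGm : ∀ t x x' w w', x ≤ x' → w ≤ w' → G t x w ≤ G t x' w')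
    (hHm : ∀ t x x' w w', x ≤ x' → w ≤ w' → H t x w ≤ H t x' w')
    {x0 w0 x1 w1 : ℝ → ℝ} (cx0 : Continuous x0) (cw0 : Continuous w0) (cx1 : Continuous x1)
    (cw1 : Continuous w1) (px0 : Function.Periodic x0 T) (pw0 : Function.Periodic w0 T)
    (px1 : Function.Periodic x1 T) (pw1 : Function.Periodic w1 T)
    (hx : ∀ t, x0 t ≤ x1 t) (hw : ∀ t, w0 t ≤ w1 t)
    (sx0 : ∀ t, x0 t ≤ Rop k (fun s => G s (x0 s) (w0 s)) t)
    (sw0 : ∀ t, w0 t ≤ Lop k (fun s => H s (x0 s) (w0 s)) t)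
    (sx1 : ∀ t, Rop k (fun s => G s (x1 s) (w1 s)) t ≤ x1 t)
    (sw1 : ∀ t, Lop k (fun s => H s (x1 s) (w1 s)) t ≤ w1 t) :
    ∃ x w : ℝ → ℝ, Function.Periodic x T ∧ Function.Periodic w T ∧
      (∀ t, HasDerivAt x (G t (x t) (w t) - k * x t) t) ∧
      (∀ t, HasDerivAt w (k * w t - H t (x t) (w t)) t) := by
  -- admissible pairs
  let S : (ℝ → ℝ) × (ℝ → ℝ) → Prop := fun z => Measurable z.1 ∧ Measurable z.2 ∧
    Function.Periodic z.1 T ∧ Function.Periodic z.2 T ∧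
    (∀ t, x0 t ≤ z.1 t) ∧ (∀ t, w0 t ≤ z.2 t) ∧ (∀ t, z.1 t ≤ x1 t) ∧ (∀ t, z.2 t ≤ w1 t)
  let Φ : (ℝ → ℝ) × (ℝ → ℝ) → (ℝ → ℝ) × (ℝ → ℝ) := fun z =>
    (Rop k (fun s => G s (z.1 s) (z.2 s)), Lop k (fun s => H s (z.1 s) (z.2 s)))
  have S0 : S (x0, w0) := ⟨cx0.measurable, cw0.measurable, px0, pw0, fun _ => le_rfl, fun _ => le_rfl, hx, hw⟩
  have S1 : S (x1, w1) := ⟨cx1.measurable, cw1.measurable, px1, pw1, hx, hw, fun _ => le_rfl, fun _ => le_rfl⟩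
  -- uniform bounds
  have hbG : ∃ M, ∀ z, S z → ∀ t, |G t (z.1 t) (z.2 t)| ≤ M := by
    obtain ⟨A, hA⟩ := per_bdd hT (f := fun t => G t (x0 t) (w0 t))
      (hG.comp (continuous_id.prodMk (cx0.prodMk cw0))) (fun t => by simp only [px0 t, pw0 t, hGp])
    obtain ⟨B, hB⟩ := per_bdd hT (f := fun t => G t (x1 t) (w1 t))
      (hG.comp (continuous_id.prodMk (cx1.prodMk cw1))) (fun t => by simp only [px1 t, pw1 t, hGp])
    refine ⟨max A B, fun z hz t => ?_⟩
    obtain ⟨_, _, _, _, h1, h2, h3, h4⟩ := hz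
    have e1 := hGm t _ _ _ _ (h1 t) (h2 t)
    have e2 := hGm t _ _ _ _ (h3 t) (h4 t)
    have e3 := abs_le.1 (hA t)
    have e4 := abs_le.1 (hB t)
    have := le_max_left A B
    have := le_max_right A B
    exact abs_le.2 ⟨by linarith, by linarith⟩
  have hbH : ∃ M, ∀ z, S z → ∀ t, |H t (z.1 t) (z.2 t)| ≤ M := by
    obtain ⟨A, hA⟩ := per_bdd hT (f := fun t => H t (x0 t) (w0 t))
      (hH.comp (continuous_id.prodMk (cx0.prodMk cw0))) (fun t => by simp only [px0 t, pw0 t, hHp])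
    obtain ⟨B, hB⟩ := per_bdd hT (f := fun t => H t (x1 t) (w1 t))
      (hH.comp (continuous_id.prodMk (cx1.prodMk cw1))) (fun t => by simp only [px1 t, pw1 t, hHp])
    refine ⟨max A B, fun z hz t => ?_⟩
    obtain ⟨_, _, _, _, h1, h2, h3, h4⟩ := hz
    have e1 := hHm t _ _ _ _ (h1 t) (h2 t)
    have e2 := hHm t _ _ _ _ (h3 t) (h4 t)
    have e3 := abs_le.1 (hA t)
    have e4 := abs_le.1 (hB t)
    have := le_max_left A B
    have := le_max_right A B
    exact abs_le.2 ⟨by linarith, by linarith⟩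
  obtain ⟨MG, hMG⟩ := hbG
  obtain ⟨MH, hMH⟩ := hbH
  have mG : ∀ z, S z → Measurable (fun t => G t (z.1 t) (z.2 t)) := fun z hz =>
    hG.measurable.comp (measurable_id.prodMk (hz.1.prodMk hz.2.1))
  have mH : ∀ z, S z → Measurable (fun t => H t (z.1 t) (z.2 t)) := fun z hz =>
    hH.measurable.comp (measurable_id.prodMk (hz.1.prodMk hz.2.1))
  have monoΦ : ∀ z z', S z → S z' → (∀ t, z.1 t ≤ z'.1 t) → (∀ t, z.2 t ≤ z'.2 t) →
      (∀ t, (Φ z).1 t ≤ (Φ z').1 t) ∧ (∀ t, (Φ z).2 t ≤ (Φ z').2 t) := by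
    intro z z' hz hz' h1 h2
    exact ⟨Rop_mono hk (mG z hz) (hMG z hz) (mG z' hz') (hMG z' hz') (fun t => hGm _ _ _ _ _ (h1 t) (h2 t)),
      Lop_mono hk (mH z hz) (hMH z hz) (mH z' hz') (hMH z' hz') (fun t => hHm _ _ _ _ _ (h1 t) (h2 t))⟩
  have SΦ : ∀ z, S z → S (Φ z) := by
    intro z hz
    have hz' := hz
    obtain ⟨h1, h2, h3, h4, h5, h6, h7, h8⟩ := hz'
    have a1 := monoΦ _ _ S0 hz h5 h6
    have a2 := monoΦ _ _ hz S1 h7 h8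
    refine ⟨(Rop_cont hk (mG z hz) (hMG z hz)).measurable, (Lop_cont hk (mH z hz) (hMH z hz)).measurable,
      Rop_per (h := fun s => G s (z.1 s) (z.2 s)) (fun t => by simp only [h3 t, h4 t, hGp]),
      Lop_per (h := fun s => H s (z.1 s) (z.2 s)) (fun t => by simp only [h3 t, h4 t, hHp]),
      fun t => (sx0 t).trans (a1.1 t), fun t => (sw0 t).trans (a1.2 t),
      fun t => (a2.1 t).trans (sx1 t), fun t => (a2.2 t).trans (sw1 t)⟩
  let Z : ℕ → (ℝ → ℝ) × (ℝ → ℝ) := fun n => Φ^[n] (x0, w0)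
  have Zs : ∀ n, Z (n + 1) = Φ (Z n) := fun n => Function.iterate_succ_apply' Φ n _
  have SZ : ∀ n, S (Z n) := by
    intro n
    induction n with
    | zero => exact S0
    | succ n ih => rw [Zs]; exact SΦ _ ih
  have stepZ : ∀ n, (∀ t, (Z n).1 t ≤ (Z (n+1)).1 t) ∧ (∀ t, (Z n).2 t ≤ (Z (n+1)).2 t) := by
    intro n
    induction n with
    | zero => exact ⟨sx0, sw0⟩
    | succ n ih =>
      have := monoΦ _ _ (SZ n) (SZ (n+1)) ih.1 ih.2
      rw [← Zs, ← Zs] at this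
      exact this
  let x : ℝ → ℝ := fun t => ⨆ n, (Z n).1 t
  let w : ℝ → ℝ := fun t => ⨆ n, (Z n).2 t
  have tx : ∀ t, Filter.Tendsto (fun n => (Z n).1 t) Filter.atTop (nhds (x t)) := fun t =>
    tendsto_atTop_ciSup (monotone_nat_of_le_succ fun n => (stepZ n).1 t)
      ⟨x1 t, by rintro _ ⟨n, rfl⟩; exact (SZ n).2.2.2.2.2.2.1 t⟩
  have tw : ∀ t, Filter.Tendsto (fun n => (Z n).2 t) Filter.atTop (nhds (w t)) := fun t =>
    tendsto_atTop_ciSup (monotone_nat_of_le_succ fun n => (stepZ n).2 t)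
      ⟨w1 t, by rintro _ ⟨n, rfl⟩; exact (SZ n).2.2.2.2.2.2.2 t⟩
  have Sxw : S (x, w) := by
    refine ⟨measurable_of_tendsto_metrizable (fun n => (SZ n).1) (tendsto_pi_nhds.2 tx),
      measurable_of_tendsto_metrizable (fun n => (SZ n).2.1) (tendsto_pi_nhds.2 tw), ?_, ?_, ?_, ?_, ?_, ?_⟩
    · intro t
      show (⨆ n, (Z n).1 (t + T)) = ⨆ n, (Z n).1 t
      congr 1; ext n; exact (SZ n).2.2.1 t
    · intro t
      show (⨆ n, (Z n).2 (t + T)) = ⨆ n, (Z n).2 t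
      congr 1; ext n; exact (SZ n).2.2.2.1 t
    · exact fun t => ge_of_tendsto' (tx t) fun n => (SZ n).2.2.2.2.1 t
    · exact fun t => ge_of_tendsto' (tw t) fun n => (SZ n).2.2.2.2.2.1 t
    · exact fun t => le_of_tendsto' (tx t) fun n => (SZ n).2.2.2.2.2.2.1 t
    · exact fun t => le_of_tendsto' (tw t) fun n => (SZ n).2.2.2.2.2.2.2 t
  have ex : x = Rop k (fun s => G s (x s) (w s)) := by
    ext t
    refine tendsto_nhds_unique ((tx t).comp (Filter.tendsto_add_atTop_nat 1)) ?_
    have := Rop_tendsto hk (h := fun n s => G s ((Z n).1 s) ((Z n).2 s)) (h' := fun s => G s (x s) (w s))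
      (fun n => mG _ (SZ n)) (fun n => hMG _ (SZ n)) (fun s =>
        (hG.tendsto (s, x s, w s)).comp (tendsto_const_nhds.prodMk_nhds ((tx s).prodMk_nhds (tw s)))) t
    refine this.congr fun n => ?_
    show _ = (Z (n+1)).1 t
    rw [Zs]
  have ew : w = Lop k (fun s => H s (x s) (w s)) := by
    ext t
    refine tendsto_nhds_unique ((tw t).comp (Filter.tendsto_add_atTop_nat 1)) ?_
    have := Lop_tendsto hk (h := fun n s => H s ((Z n).1 s) ((Z n).2 s)) (h' := fun s => H s (x s) (w s))
      (fun n => mH _ (SZ n)) (fun n => hMH _ (SZ n)) (fun s =>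
        (hH.tendsto (s, x s, w s)).comp (tendsto_const_nhds.prodMk_nhds ((tx s).prodMk_nhds (tw s)))) t
    refine this.congr fun n => ?_
    show _ = (Z (n+1)).2 t
    rw [Zs]
  have cx : Continuous x := by rw [ex]; exact Rop_cont hk (mG _ Sxw) (hMG _ Sxw)
  have cw : Continuous w := by rw [ew]; exact Lop_cont hk (mH _ Sxw) (hMH _ Sxw)
  refine ⟨x, w, Sxw.2.2.1, Sxw.2.2.2.1, fun t => ?_, fun t => ?_⟩
  · have := Rop_deriv hk (h := fun s => G s (x s) (w s))
      (hG.comp (continuous_id.prodMk (cx.prodMk cw))) (hMG _ Sxw) t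
    rwa [← ex] at this
  · have := Lop_deriv hk (h := fun s => H s (x s) (w s))
      (hH.comp (continuous_id.prodMk (cx.prodMk cw))) (hMH _ Sxw) t
    rwa [← ew] at this

/-- The inverse of `phi c`. -/
noncomputable def psi (c z : ℝ) : ℝ := z / Real.sqrt (1 + z ^ 2 / c ^ 2)

lemma psi_arg_pos (c z : ℝ) : 0 < 1 + z ^ 2 / c ^ 2 := by positivity

lemma psi_cont (c : ℝ) : Continuous (psi c) := by
  unfold psi
  refine continuous_id.div (by fun_prop) fun z => ?_
  exact (Real.sqrt_pos.2 (psi_arg_pos c z)).ne'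

lemma psi_zero (c : ℝ) : psi c 0 = 0 := by simp [psi]

lemma psi_sq (c z : ℝ) : psi c z ^ 2 = z ^ 2 / (1 + z ^ 2 / c ^ 2) := by
  rw [psi, div_pow, Real.sq_sqrt (psi_arg_pos c z).le]

lemma psi_lt {c : ℝ} (hc : 0 < c) (z : ℝ) : |psi c z| < c := by
  apply abs_lt_of_sq_lt_sq _ hc.le
  rw [psi_sq, div_lt_iff₀ (psi_arg_pos c z)]
  have : c ^ 2 * (1 + z ^ 2 / c ^ 2) = c ^ 2 + z ^ 2 := by field_simp
  rw [this]
  have : 0 < c ^ 2 := by positivity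
  linarith

lemma phi_psi {c : ℝ} (hc : 0 < c) (z : ℝ) : phi c (psi c z) = z := by
  have h := psi_arg_pos c z
  have hq := Real.sqrt_pos.2 h
  have : 1 - psi c z ^ 2 / c ^ 2 = (1 + z ^ 2 / c ^ 2)⁻¹ := by
    rw [psi_sq]
    have h2 : c ^ 2 + z ^ 2 ≠ 0 := by positivity
    field_simp
    ring
  rw [phi, this, Real.sqrt_inv, psi]
  field_simp

lemma psi_deriv {c : ℝ} (hc : 0 < c) (z : ℝ) :
    HasDerivAt (psi c) (1 / Real.sqrt (1 + z ^ 2 / c ^ 2) ^ 3) z := by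
  have h := psi_arg_pos c z
  have hq := Real.sqrt_pos.2 h
  have h1 : HasDerivAt (fun z => 1 + z ^ 2 / c ^ 2) (2 * z / c ^ 2) z := by
    have := ((hasDerivAt_pow 2 z).div_const (c ^ 2)).const_add 1
    simpa using this
  have h2 := (hasDerivAt_id z).div (h1.sqrt h.ne') hq.ne'
  refine HasDerivAt.congr_deriv h2 ?_
  have hs := Real.sq_sqrt h.le
  set q := Real.sqrt (1 + z ^ 2 / c ^ 2)
  have e : q ^ 2 * c ^ 2 = c ^ 2 + z ^ 2 := by rw [hs]; field_simp
  simp only [id]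
  field_simp
  linarith

lemma psi_incr {c R : ℝ} (hc : 0 < c) (hR : 0 < R) : ∃ δ, 0 < δ ∧ δ ≤ 1 ∧
    ∀ y z, -R ≤ y → y ≤ z → z ≤ R → δ * (z - y) ≤ psi c z - psi c y ∧ psi c z - psi c y ≤ z - y := by
  have hQ1 : ∀ z : ℝ, 1 ≤ Real.sqrt (1 + z ^ 2 / c ^ 2) := by
    intro z
    rw [Real.one_le_sqrt]
    have : 0 ≤ z ^ 2 / c ^ 2 := by positivity
    linarith
  refine ⟨1 / Real.sqrt (1 + R ^ 2 / c ^ 2) ^ 3, by have := hQ1 R; positivity, ?_, ?_⟩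
  · rw [div_le_one (by have := hQ1 R; positivity)]
    exact one_le_pow₀ (hQ1 R)
  · intro y z hy hyz hz
    have key : ∀ s ∈ Icc (-R) R, 1 / Real.sqrt (1 + R ^ 2 / c ^ 2) ^ 3 ≤ 1 / Real.sqrt (1 + s ^ 2 / c ^ 2) ^ 3 := by
      intro s hs
      have := hQ1 s
      have hsq : s ^ 2 ≤ R ^ 2 := sq_le_sq' hs.1 hs.2
      gcongr
    have dd : Differentiable ℝ (psi c) := fun z => (psi_deriv hc z).differentiableAt
    constructor
    · refine Convex.mul_sub_le_image_sub_of_le_deriv (convex_Icc (-R) R) (psi_cont c).continuousOn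
        dd.differentiableOn ?_ y ⟨hy, hyz.trans hz⟩ z ⟨hy.trans hyz, hz⟩ hyz
      intro s hs
      rw [(psi_deriv hc s).deriv]
      exact key s (interior_subset hs)
    · have := Convex.image_sub_le_mul_sub_of_deriv_le (convex_Icc (-R) R) (psi_cont c).continuousOn
        dd.differentiableOn (C := 1) ?_ y ⟨hy, hyz.trans hz⟩ z ⟨hy.trans hyz, hz⟩ hyz
      · linarith
      · intro s hs
        rw [(psi_deriv hc s).deriv, div_le_one (by have := hQ1 s; positivity)]
        exact one_le_pow₀ (hQ1 s)

lemma exists_trunc {c R : ℝ} (hc : 0 < c) (hR : 0 < R) : ∃ (f : ℝ → ℝ) (δ : ℝ), 0 < δ ∧ Continuous f ∧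
    (∀ z, |z| ≤ R → f z = psi c z) ∧
    ∀ y z, y ≤ z → δ * (z - y) ≤ f z - f y ∧ f z - f y ≤ z - y := by
  obtain ⟨δ, hδ, hδ1, h⟩ := psi_incr hc hR
  refine ⟨fun z => psi c (max (-R) (min z R)) + δ * (z - max (-R) (min z R)), δ, hδ, ?_, ?_, ?_⟩
  · have := psi_cont c
    fun_prop
  · intro z hz
    have := abs_le.1 hz
    simp [min_eq_left this.2, max_eq_right this.1]
  · intro y z hyz
    set y' := max (-R) (min y R) with hy'
    set z' := max (-R) (min z R) with hz'
    have a1 : -R ≤ y' := le_max_left _ _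
    have a2 : z' ≤ R := max_le (by linarith) (min_le_right _ _)
    have a3 : y' ≤ z' := max_le_max le_rfl (min_le_min hyz le_rfl)
    have a4 : z' - y' ≤ z - y := by
      rw [hy', hz']
      rcases le_total y R with h1 | h1 <;> rcases le_total z R with h2 | h2 <;>
      simp only [h1, h2, min_eq_left, min_eq_right] <;>
      rcases max_cases (-R) y with h3 | h3 <;> rcases max_cases (-R) z with h4 | h4 <;>
      rcases max_cases (-R) R with h5 | h5 <;> linarith
    obtain ⟨b1, b2⟩ := h y' z' a1 a3 a2
    simp only
    constructor
    · nlinarith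
    · nlinarith

lemma one_side {T a B : ℝ} (hT : 0 < T) (ha : 0 < a) {f : ℝ → ℝ} (f0 : f 0 = 0) (fm : StrictMono f)
    {x u q : ℝ → ℝ} (px : Function.Periodic x T)
    (dx : ∀ t, HasDerivAt x (f (u t)) t) (du : ∀ t, HasDerivAt u (q t - a * f (u t)) t)
    (hq : ∀ t, q t ≤ B) (hB : 0 ≤ B) (t : ℝ) : u t ≤ (B + 1) * T := by
  obtain ⟨s, hs, e⟩ := exists_hasDerivAt_eq_zero (f := x) (f' := fun t => f (u t)) (a := t - T) (b := t)
    (by linarith) (fun s _ => (dx s).continuousAt.continuousWithinAt)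
    (by have := px (t - T); simp only [sub_add_cancel] at this; exact this.symm) (fun s _ => dx s)
  have us : u s = 0 := fm.injective (e.trans f0.symm)
  have := image_le_of_deriv_right_lt_deriv_boundary' (f := u) (f' := fun t => q t - a * f (u t)) (a := s) (b := t)
    (fun r _ => (du r).continuousAt.continuousWithinAt) (fun r _ => (du r).hasDerivWithinAt)
    (B := fun r => (B + 1) * (r - s)) (B' := fun _ => B + 1) (by simp [us]) (by fun_prop)
    (fun r _ => by
      have := ((hasDerivAt_id r).sub_const s).const_mul (B + 1)
      simpa using this.hasDerivWithinAt)
    (fun r hr h => by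
      have h1 : 0 ≤ u r := by
        rw [h]; exact mul_nonneg (by linarith) (by linarith [hr.1])
      have h2 : 0 ≤ f (u r) := by rw [← f0]; exact fm.monotone h1
      have := mul_nonneg ha.le h2
      have := hq r
      linarith) (x := t) ⟨hs.2.le, le_rfl⟩
  refine this.trans ?_
  have := hs.1
  apply mul_le_mul_of_nonneg_left <;> linarith

lemma u_bound {T a B : ℝ} (hT : 0 < T) (ha : 0 < a) {f : ℝ → ℝ} (f0 : f 0 = 0) (fm : StrictMono f)
    {x u q : ℝ → ℝ} (px : Function.Periodic x T)
    (dx : ∀ t, HasDerivAt x (f (u t)) t) (du : ∀ t, HasDerivAt u (q t - a * f (u t)) t)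
    (hq : ∀ t, |q t| ≤ B) (hB : 0 ≤ B) (t : ℝ) : |u t| ≤ (B + 1) * T := by
  refine abs_le.2 ⟨?_, one_side hT ha f0 fm px dx du (fun t => (abs_le.1 (hq t)).2) hB t⟩
  have := one_side (f := fun z => - f (-z)) (x := fun t => - x t) (u := fun t => - u t)
    (q := fun t => - q t) hT ha (by simp [f0])
    (fun y z h => by simp only; exact neg_lt_neg (fm (neg_lt_neg h)))
    (fun t => by simp only [px t])
    (fun t => HasDerivAt.congr_deriv (dx t).neg (by simp))
    (fun t => by
      refine HasDerivAt.congr_deriv (du t).neg ?_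
      rw [neg_neg]; ring)
    (fun t => by linarith [(abs_le.1 (hq t)).1]) hB t
  linarith

lemma psi_strictMono {c : ℝ} (hc : 0 < c) : StrictMono (psi c) := by
  intro y z h
  obtain ⟨δ, hδ, -, hh⟩ := psi_incr (R := |y| + |z| + 1) hc (by positivity)
  have := (hh y z (by linarith [neg_abs_le y, abs_nonneg z]) h.le (by linarith [le_abs_self z, abs_nonneg y])).1
  have := mul_pos hδ (sub_pos.2 h)
  linarith

lemma psi_lip {c : ℝ} (hc : 0 < c) {y z : ℝ} (h : y ≤ z) : psi c z - psi c y ≤ z - y := by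
  obtain ⟨δ, hδ, -, hh⟩ := psi_incr (R := |y| + |z| + 1) hc (by positivity)
  exact (hh y z (by linarith [neg_abs_le y, abs_nonneg z]) h (by linarith [le_abs_self z, abs_nonneg y])).2

lemma exists_base {c a T : ℝ} (hc : 0 < c) (ha : 0 < a) (hT : 0 < T) {p : ℝ → ℝ} (hp : Continuous p)
    (pp : Function.Periodic p T) (h0 : (∫ t in (0:ℝ)..T, p t) = 0) :
    ∃ x u : ℝ → ℝ, Function.Periodic x T ∧ Function.Periodic u T ∧
      (∀ t, HasDerivAt x (psi c (u t)) t) ∧ (∀ t, HasDerivAt u (p t - a * psi c (u t)) t) := by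
  let W : ℝ → ℝ := fun t => ∫ s in (0:ℝ)..t, p s
  have dW : ∀ t, HasDerivAt W (p t) t := fun t =>
    intervalIntegral.integral_hasDerivAt_right (hp.intervalIntegrable 0 t)
      (hp.stronglyMeasurableAtFilter _ _) hp.continuousAt
  have cW : Continuous W := continuous_iff_continuousAt.2 fun t => (dW t).continuousAt
  have pW : Function.Periodic W T := by
    intro t
    have h1 := intervalIntegral.integral_add_adjacent_intervals (hp.intervalIntegrable (μ := volume) 0 t)
      (hp.intervalIntegrable t (t + T))
    have h2 := pp.intervalIntegral_add_eq t 0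
    rw [zero_add, h0] at h2
    show (∫ s in (0:ℝ)..(t + T), p s) = ∫ s in (0:ℝ)..t, p s
    linarith
  obtain ⟨M, hM⟩ := per_bdd hT cW pW
  have cpsi := psi_cont c
  have M0 : 0 ≤ M := (abs_nonneg _).trans (hM 0)
  have hMa : a * (M / a) = M := by field_simp
  have hMa' : a * -(M / a) = -M := by rw [mul_neg, hMa]
  have pos : ∀ z, 0 ≤ z → 0 ≤ psi c z := fun z hz => by
    rw [← psi_zero c]; exact (psi_strictMono hc).monotone hz
  have neg : ∀ z, z ≤ 0 → psi c z ≤ 0 := fun z hz => by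
    rw [← psi_zero c]; exact (psi_strictMono hc).monotone hz
  have pconst : ∀ r : ℝ, Function.Periodic (fun _ : ℝ => r) T := fun r t => rfl
  obtain ⟨x, w, px, pw, dx, dw⟩ := mono_iter (k := a) (T := T) ha hT
    (G := fun t x _ => a * x + psi c (W t - a * x)) (H := fun _ _ _ => 0)
    (by fun_prop) (by fun_prop) (fun t x w => by simp only [pW t]) (fun t x w => rfl)
    (fun t x x' w w' h _ => by
      have h1 : W t - a * x' ≤ W t - a * x := by nlinarith
      have := psi_lip hc h1
      linarith)
    (fun _ _ _ _ _ _ _ => le_rfl)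
    (x0 := fun _ => -(M / a)) (w0 := fun _ => 0) (x1 := fun _ => M / a) (w1 := fun _ => 0)
    (by fun_prop) (by fun_prop) (by fun_prop) (by fun_prop) (pconst _) (pconst _) (pconst _) (pconst _)
    (fun t => by have : 0 ≤ M / a := by positivity
                 linarith) (fun t => le_rfl)
    (Rop_ge ha hT (x' := fun _ => 0) (fun t => hasDerivAt_const t _) (by fun_prop) (pconst _) (pconst _)
      (by fun_prop) (fun t => by simp only [pW t]) (fun t => by
        have := pos (W t - a * -(M / a)) (by rw [hMa']; linarith [(abs_le.1 (hM t)).1])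
        linarith))
    (fun t => by simp [Lop])
    (Rop_le ha hT (x' := fun _ => 0) (fun t => hasDerivAt_const t _) (by fun_prop) (pconst _) (pconst _)
      (by fun_prop) (fun t => by simp only [pW t]) (fun t => by
        have := neg (W t - a * (M / a)) (by rw [hMa]; linarith [(abs_le.1 (hM t)).2])
        linarith))
    (fun t => by simp [Lop])
  refine ⟨x, fun t => W t - a * x t, px, fun t => by simp only [px t, pW t], fun t => ?_, fun t => ?_⟩
  · exact (dx t).congr_deriv (by ring)
  · exact HasDerivAt.congr_deriv ((dW t).sub ((dx t).const_mul a)) (by ring)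

/-- Normalisation of the base solution: its oscillation is less than `π`. -/
lemma exists_base_pos {c a T : ℝ} (hc : 0 < c) (ha : 0 < a) (hT : 0 < T)
    (hcT : c * T ≤ Real.sqrt 3 * Real.pi) {p : ℝ → ℝ} (hp : Continuous p)
    (pp : Function.Periodic p T) (h0 : (∫ t in (0:ℝ)..T, p t) = 0) :
    ∃ x u : ℝ → ℝ, Function.Periodic x T ∧ Function.Periodic u T ∧
      (∀ t, HasDerivAt x (psi c (u t)) t) ∧ (∀ t, HasDerivAt u (p t - a * psi c (u t)) t) ∧
      ∀ t, 0 ≤ Real.sin (x t) := by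
  obtain ⟨x, u, px, pu, dx, du⟩ := exists_base hc ha hT hp pp h0
  have cx : Continuous x := continuous_iff_continuousAt.2 fun t => (dx t).continuousAt
  obtain ⟨m, hm, hmin⟩ := (isCompact_Icc (a := (0:ℝ)) (b := T)).exists_isMinOn
    (nonempty_Icc.2 hT.le) cx.continuousOn
  have hmin' : ∀ t, x m ≤ x t := by
    intro t
    obtain ⟨y, hy, e⟩ := px.exists_mem_Ico₀ hT t
    rw [e]
    exact hmin ⟨hy.1, hy.2.le⟩
  have lip : ∀ y z, x z - x y ≤ c * |z - y| := by
    intro y z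
    have := Convex.norm_image_sub_le_of_norm_hasDerivWithin_le (f := x) (C := c) (s := univ)
      (fun t _ => (dx t).hasDerivWithinAt) (fun t _ => (psi_lt hc (u t)).le) convex_univ
      (mem_univ y) (mem_univ z)
    exact (le_abs_self _).trans this
  have osc : ∀ t, x t - x m ≤ Real.pi := by
    intro t
    obtain ⟨y, hy, e⟩ := px.exists_mem_Ico hT t (m - T / 2)
    rw [e]
    refine (lip m y).trans ?_
    have h1 : |y - m| ≤ T / 2 := abs_le.2 ⟨by linarith [hy.1], by linarith [hy.2]⟩
    have h2 : c * |y - m| ≤ c * (T / 2) := mul_le_mul_of_nonneg_left h1 hc.le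
    have h3 : Real.sqrt 3 ≤ 2 := by
      rw [Real.sqrt_le_left (by norm_num)]; norm_num
    have := mul_le_mul_of_nonneg_right h3 Real.pi_pos.le
    linarith
  refine ⟨fun t => x t - x m, u, fun t => by simp only [px t], pu,
    fun t => (dx t).sub_const _, du, fun t => ?_⟩
  exact Real.sin_nonneg_of_nonneg_of_le_pi (by linarith [hmin' t]) (osc t)

lemma sin_sub_le {y z : ℝ} (h : y ≤ z) : Real.sin y - Real.sin z ≤ z - y := by
  have := Real.abs_sin_sub_sin_le y z
  rw [abs_of_nonpos (a := y - z) (by linarith)] at this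
  linarith [le_abs_self (Real.sin y - Real.sin z)]

/-- if `cT ≤ √3 π` then `0 ∈ I(p₀)` for every admissible forcing `p₀`. -/
theorem zero_mem_solvSet_of_small_period (c a b T : ℝ) (hc : 0 < c) (ha : 0 < a) (hb : 0 < b)
    (hT : 0 < T) (hcT : c * T ≤ Real.sqrt 3 * Real.pi) :
    ∀ p₀ : ℝ → ℝ, Continuous p₀ → Function.Periodic p₀ T →
      (∫ t in (0:ℝ)..T, p₀ t) = 0 → (0 : ℝ) ∈ solvSet c a b T p₀ := by
  intro p hp pp h0
  obtain ⟨A, v, pA, pv, dA, dv, sA⟩ := exists_base_pos hc ha hT hcT hp pp h0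
  obtain ⟨P, hP⟩ := per_bdd hT hp pp
  have P0 : 0 ≤ P := (abs_nonneg _).trans (hP 0)
  have cA : Continuous A := continuous_iff_continuousAt.2 fun t => (dA t).continuousAt
  have cv : Continuous v := continuous_iff_continuousAt.2 fun t => (dv t).continuousAt
  have cpsi := psi_cont c
  obtain ⟨f, δ, hδ, cf, hfeq, hf⟩ := exists_trunc (R := (P + b + 1) * T) hc (by positivity)
  have f0 : f 0 = 0 := by rw [hfeq 0 (by rw [abs_zero]; positivity), psi_zero]
  have fm : StrictMono f := by
    intro y z h
    have := (hf y z h.le).1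
    have := mul_pos hδ (sub_pos.2 h)
    linarith
  have fv : ∀ t, f (v t) = psi c (v t) := fun t => hfeq _
    (u_bound (B := P + b) hT ha (psi_zero c) (psi_strictMono hc) pA dA dv
      (fun t => (hP t).trans (by linarith)) (by linarith) t)
  -- choice of `k`
  obtain ⟨k, hk1, hk2⟩ : ∃ k, a + 1 ≤ k ∧ b ≤ (k - a) * (k * δ) := by
    refine ⟨a + 1 + b / δ, by have : 0 ≤ b / δ := by positivity
                              linarith, ?_⟩
    have h1 : b / δ * δ = b := by field_simp
    have h2 : 0 < b / δ := by positivity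
    have h3 : b ≤ (a + 1 + b / δ) * δ := by nlinarith
    have h4 : 1 ≤ a + 1 + b / δ - a := by linarith
    nlinarith
  have hk : 0 < k := by linarith
  have hka : 0 ≤ k - a := by linarith
  have hmonoG : ∀ x x' w w' : ℝ, x ≤ x' → w ≤ w' → k * x + f (w - k * x) ≤ k * x' + f (w' - k * x') := by
    intro x x' w w' h1 h2
    have e1 : w - k * x' ≤ w - k * x := by nlinarith
    have := (hf _ _ e1).2
    have := fm.monotone (show w - k * x' ≤ w' - k * x' by linarith)
    linarith
  have hmonoH : ∀ x x' w w' : ℝ, x ≤ x' → w ≤ w' →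
      k * w + b * Real.sin x - (k - a) * f (w - k * x) ≤
      k * w' + b * Real.sin x' - (k - a) * f (w' - k * x') := by
    intro x x' w w' h1 h2
    have e1 : w - k * x' ≤ w - k * x := by nlinarith
    have i1 := mul_le_mul_of_nonneg_left (hf _ _ e1).1 hka
    have i2 := mul_le_mul_of_nonneg_left (hf _ _ (show w - k * x' ≤ w' - k * x' by linarith)).2 hka
    have i3 := mul_le_mul_of_nonneg_left (sin_sub_le h1) hb.le
    have i4 := mul_le_mul_of_nonneg_right hk2 (sub_nonneg.2 h1)
    have i5 : 0 ≤ a * (w' - w) := mul_nonneg ha.le (by linarith)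
    nlinarith
  have pconst : ∀ r : ℝ, Function.Periodic (fun _ : ℝ => r) T := fun r t => rfl
  have dw : ∀ t, HasDerivAt (fun t => v t + k * A t) (p t + (k - a) * psi c (v t)) t := fun t =>
    HasDerivAt.congr_deriv ((dv t).add ((dA t).const_mul k)) (by ring)
  have simp1 : ∀ t, v t + k * A t - k * A t = v t := fun t => by ring
  have simp2 : ∀ t, v t + k * A t + k * Real.pi - k * (A t + Real.pi) = v t := fun t => by ring
  obtain ⟨x, w, px, pw, dx, dw⟩ := mono_iter (k := k) (T := T) hk hT
    (G := fun _ x w => k * x + f (w - k * x))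
    (H := fun t x w => (k * w + b * Real.sin x - (k - a) * f (w - k * x)) - p t)
    (by fun_prop) (by fun_prop) (fun t x w => rfl) (fun t x w => by simp only [pp t])
    (fun t => hmonoG)
    (fun t x x' w w' h1 h2 => sub_le_sub_right (hmonoH x x' w w' h1 h2) _)
    (x0 := A) (w0 := fun t => v t + k * A t) (x1 := fun t => A t + Real.pi)
    (w1 := fun t => v t + k * A t + k * Real.pi)
    (by fun_prop) (by fun_prop) (by fun_prop) (by fun_prop) pA (fun t => by simp only [pA t, pv t])
    (fun t => by simp only [pA t]) (fun t => by simp only [pA t, pv t])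
    (fun t => by linarith [Real.pi_pos])
    (fun t => by have := mul_pos hk Real.pi_pos
                 linarith)
    (Rop_ge hk hT dA (by fun_prop) pA (fun t => by simp only [pv t])
      (by fun_prop) (fun t => by simp only [pA t, pv t]) (fun t => by rw [simp1, fv]))
    (Lop_ge hk hT dw (by fun_prop) (fun t => by simp only [pA t, pv t]) (fun t => by simp only [pp t, pv t])
      (by fun_prop) (fun t => by simp only [pA t, pv t, pp t]) (fun t => by
        rw [simp1, fv]
        have := mul_nonneg hb.le (sA t)
        linarith))
    (Rop_le hk hT (fun t => (dA t).add_const _) (by fun_prop) (fun t => by simp only [pA t])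
      (fun t => by simp only [pv t])
      (by fun_prop) (fun t => by simp only [pA t, pv t]) (fun t => by rw [simp2, fv]))
    (Lop_le hk hT (fun t => (dw t).add_const _) (by fun_prop) (fun t => by simp only [pA t, pv t])
      (fun t => by simp only [pp t, pv t])
      (by fun_prop) (fun t => by simp only [pA t, pv t, pp t]) (fun t => by
        rw [simp2, fv, Real.sin_add_pi]
        have := mul_nonneg hb.le (sA t)
        linarith))
  have dx' : ∀ t, HasDerivAt x (f (w t - k * x t)) t := fun t => (dx t).congr_deriv (by ring)
  have du : ∀ t, HasDerivAt (fun t => w t - k * x t) ((p t - b * Real.sin (x t)) - a * f (w t - k * x t)) t :=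
    fun t => HasDerivAt.congr_deriv ((dw t).sub ((dx' t).const_mul k)) (by ring)
  have hbd : ∀ t, |p t - b * Real.sin (x t)| ≤ P + b := by
    intro t
    have h1 := abs_le.1 (hP t)
    have h2 := mul_le_mul_of_nonneg_left (Real.sin_le_one (x t)) hb.le
    have h3 := mul_le_mul_of_nonneg_left (Real.neg_one_le_sin (x t)) hb.le
    exact abs_le.2 ⟨by linarith, by linarith⟩
  have fu : ∀ t, f (w t - k * x t) = psi c (w t - k * x t) := fun t => hfeq _
    (u_bound (u := fun t => w t - k * x t) (B := P + b) hT ha f0 fm px dx' du hbd (by linarith) t)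
  have cx : Continuous x := continuous_iff_continuousAt.2 fun t => (dx t).continuousAt
  have cw : Continuous w := continuous_iff_continuousAt.2 fun t => (dw t).continuousAt
  have ed : deriv x = fun t => psi c (w t - k * x t) := by
    ext t; rw [(dx' t).deriv, fu]
  have ephi : (fun t => phi c (deriv x t)) = fun t => w t - k * x t := by
    ext t; rw [ed]; exact phi_psi hc _
  have ed2 : deriv (fun t => w t - k * x t) =
      fun t => (p t - b * Real.sin (x t)) - a * f (w t - k * x t) := by
    ext t; exact (du t).deriv
  refine ⟨x, px, ?_, ?_, ?_, ?_⟩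
  · rw [contDiff_one_iff_deriv]
    refine ⟨fun t => (dx t).differentiableAt, ?_⟩
    rw [ed]
    fun_prop
  · intro t
    rw [ed]
    exact psi_lt hc _
  · rw [ephi, contDiff_one_iff_deriv]
    refine ⟨fun t => (du t).differentiableAt, ?_⟩
    rw [ed2]
    fun_prop
  · intro t
    rw [ephi, ed2, ed]
    simp only [fu]
    ring
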